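/- arXiv:math/0612658 — 6 statements merged into one kernel-verified Lean document; each statement's English description precedes it below -/
import Mathlib

section
/- Let S ⊆ ℕ, let d ≥ 1, and for i ≥ 1 set S + i = {s + i : s ∈ S} and S_d = ⋃_{i=1}^d ((S + i) ∩ S). Then for every n ≥ 1 one has the integer inequality |(ℕ ∖ S) ∩ ℕ_n| ≥ d · ( |(S ∖ S_d) ∩ ℕ_n| − 1 ). -/
/-- For `S ⊆ ℕ` and `d ≥ 1`, the set `S_d = ⋃_{i=1}^d ((S + i) ∩ S)`, where
`S + i = {s + i : s ∈ S}`.  In other words, `S_d` consists of those `s ∈ S` such that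
some element of `S` lies in the interval `[s − d, s − 1]`. -/
def sparseSd (S : Set ℕ) (d : ℕ) : Set ℕ :=
  ⋃ i ∈ Finset.Icc 1 d, (((· + i) '' S) ∩ S)

theorem mem_sparseSd {S : Set ℕ} {d s : ℕ} :
    s ∈ sparseSd S d ↔ s ∈ S ∧ ∃ r ∈ S, r < s ∧ s ≤ r + d := by
  simp only [sparseSd, Set.mem_iUnion, Set.mem_inter_iff, Set.mem_image, Finset.mem_Icc]
  constructor
  · rintro ⟨i, ⟨h1, h2⟩, ⟨r, hr, rfl⟩, hs⟩
    exact ⟨hs, r, hr, by omega, by omega⟩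
  · rintro ⟨hs, r, hr, h1, h2⟩
    exact ⟨s - r, ⟨by omega, by omega⟩, ⟨r, hr, by omega⟩, hs⟩

/-- Every element of `S` below an element of `S \ S_d` is more than `d` below it. -/
theorem add_lt_of_mem_diff_sparseSd {S : Set ℕ} {d r t : ℕ} (hr : r ∈ S)
    (ht : t ∈ S \ sparseSd S d) (hrt : r < t) : r + d < t := by
  by_contra! h
  exact ht.2 (mem_sparseSd.2 ⟨ht.1, r, hr, hrt, h⟩)

/-- The estimate (3.1) in the proof of Lemma 3.3: for every `n ≥ 1`,
`|Sᶜ ∩ ℕ_n| ≥ d * (|(S \ S_d) ∩ ℕ_n| − 1)` as integers, where `ℕ_n = {0, …, n−1}`. -/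
theorem complement_card_ge (S : Set ℕ) (d : ℕ) (hd : 1 ≤ d) (n : ℕ) (hn : 1 ≤ n) :
    (d : ℤ) * ((((S \ sparseSd S d) ∩ Set.Iio n).ncard : ℤ) - 1)
      ≤ ((Sᶜ ∩ Set.Iio n).ncard : ℤ) := by
  set T : Set ℕ := (S \ sparseSd S d) ∩ Set.Iio n
  have hfin : T.Finite := (Set.finite_Iio n).inter_of_right _
  rcases T.eq_empty_or_nonempty with h0 | hne
  · rw [h0, Set.ncard_empty]
    push_cast
    linarith [Int.natCast_nonneg (Sᶜ ∩ Set.Iio n).ncard, Int.natCast_nonneg d]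
  obtain ⟨m, hm, hmin⟩ := hfin.exists_minimal hne
  have hlt : ∀ t ∈ T \ {m}, m + d < t := by
    rintro t ⟨ht, htm⟩
    refine add_lt_of_mem_diff_sparseSd hm.1.1 ht.1 ?_
    by_contra! h
    exact htm (le_antisymm h (hmin ht h))
  have hmaps : ∀ p ∈ (T \ {m}) ×ˢ Set.Icc 1 d, p.1 - p.2 ∈ Sᶜ ∩ Set.Iio n := by
    rintro ⟨t, i⟩ ⟨ht, hi1, hi2⟩
    have hmt := hlt t ht
    have htn : t < n := ht.1.2
    dsimp only at *
    refine ⟨fun hS => ?_, Set.mem_Iio.2 (by omega)⟩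
    have := add_lt_of_mem_diff_sparseSd hS ht.1.1 (by omega)
    omega
  have hinj : Set.InjOn (fun p : ℕ × ℕ => p.1 - p.2) ((T \ {m}) ×ˢ Set.Icc 1 d) := by
    rintro ⟨t, i⟩ ⟨ht, hi1, hi2⟩ ⟨u, j⟩ ⟨hu, hj1, hj2⟩ h
    have hmt := hlt t ht
    have hmu := hlt u hu
    dsimp only at *
    rcases lt_trichotomy t u with htu | rfl | hut
    · have := add_lt_of_mem_diff_sparseSd ht.1.1.1 hu.1.1 htu
      omega
    · rw [Prod.mk.injEq]
      omega
    · have := add_lt_of_mem_diff_sparseSd hu.1.1.1 ht.1.1 hut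
      omega
  have hcard := Set.ncard_le_ncard_of_injOn _ hmaps hinj ((Set.finite_Iio n).inter_of_right _)
  have hIcc : (Set.Icc 1 d).ncard = d := by
    rw [← Finset.coe_Icc, Set.ncard_coe_finset, Nat.card_Icc, Nat.add_sub_cancel]
  rw [Set.ncard_prod, hIcc] at hcard
  have hsub := Set.ncard_sdiff_singleton_add_one hm hfin
  rw [← hsub]
  push_cast
  rw [add_sub_cancel_right, mul_comm]
  exact_mod_cast hcard
end

section
/- Let Q be a ℤ-graded ring and S a graded subring of Q contained in nonnegative degrees, and let T = T(S) be the maximal right torsion extension of S in Q. Suppose that S is left torsion closed in Q and that T·S_{≥n} ⊆ S for some n ≥ 0. Then S equals the idealizer of the left ideal I = T·S_{≥n} of T; that is, S = {θ ∈ Q : I·θ ⊆ I}, where I is the additive subgroup of Q generated by all products t·s with t ∈ T and s ∈ S_{≥n}. -/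
variable {Q : Type*} [Ring Q]

/-- For a graded subring `S` of a `ℤ`-graded ring `Q`, the set
`S_{≥n} = S ∩ ⊕_{i≥n} Q_i` of elements of `S` all of whose homogeneous components
have degree at least `n`. -/
def degGE (𝒜 : ℤ → AddSubgroup Q) [GradedRing 𝒜] (S : Subring Q) (n : ℤ) : Set Q :=
  {x | x ∈ S ∧ ∀ i : ℤ, i < n → GradedRing.proj 𝒜 i x = 0}

/-- The maximal right torsion extension
`T(S) = {x ∈ Q : x · S_{≥n} ⊆ S for some n ≥ 0}`. -/
def maxRightTorsExt (𝒜 : ℤ → AddSubgroup Q) [GradedRing 𝒜] (S : Subring Q) : Set Q :=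
  {x | ∃ n : ℤ, 0 ≤ n ∧ ∀ s ∈ degGE 𝒜 S n, x * s ∈ S}

/-- The additive subgroup `I = T(S)·S_{≥n}` of `Q` generated by all products `t * s`
with `t ∈ T(S)` and `s ∈ S_{≥n}` (a left ideal of `T(S)`). -/
def torsLeftIdeal (𝒜 : ℤ → AddSubgroup Q) [GradedRing 𝒜] (S : Subring Q) (n : ℤ) :
    AddSubgroup Q :=
  AddSubgroup.closure {q : Q | ∃ t ∈ maxRightTorsExt 𝒜 S, ∃ s ∈ degGE 𝒜 S n, q = t * s}

/-- If the components of `x` below degree `m` and those of `y` below degree `n` vanish, then the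
components of `x * y` below degree `m + n` vanish. -/
theorem GradedRing.proj_mul_eq_zero_of_lt (𝒜 : ℤ → AddSubgroup Q) [GradedRing 𝒜] {m n : ℤ}
    {x y : Q} (hx : ∀ i < m, GradedRing.proj 𝒜 i x = 0) (hy : ∀ i < n, GradedRing.proj 𝒜 i y = 0)
    {i : ℤ} (hi : i < m + n) : GradedRing.proj 𝒜 i (x * y) = 0 := by
  classical
  rw [← DirectSum.sum_support_decompose 𝒜 x, ← DirectSum.sum_support_decompose 𝒜 y,
    Finset.sum_mul_sum, map_sum]
  refine Finset.sum_eq_zero fun j _ => ?_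
  rw [map_sum]
  refine Finset.sum_eq_zero fun k _ => ?_
  rw [← GradedRing.proj_apply 𝒜 j x, ← GradedRing.proj_apply 𝒜 k y]
  by_cases hj : j < m
  · rw [hx j hj, zero_mul, map_zero]
  by_cases hk : k < n
  · rw [hy k hk, mul_zero, map_zero]
  rw [GradedRing.proj_apply]
  refine DirectSum.decompose_of_mem_ne 𝒜 (i := j + k) ?_ (by lia)
  exact SetLike.mul_mem_graded (SetLike.coe_mem _) (SetLike.coe_mem _)

/-- **Lemma 7.6.** Let `S` be a graded subring, contained in nonnegative degrees, of a
`ℤ`-graded ring `Q`, and let `T = T(S)` be the maximal right torsion extension of `S`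
in `Q`.  If `S` is left torsion closed in `Q` and `T·S_{≥n} ⊆ S` for some `n ≥ 0`, then
`S` is the idealizer `{θ ∈ Q : I·θ ⊆ I}` of the left ideal `I = T·S_{≥n}` of `T`. -/
theorem subring_eq_idealizer (𝒜 : ℤ → AddSubgroup Q) [GradedRing 𝒜] (S : Subring Q)
    (hcomp : ∀ x ∈ S, ∀ i : ℤ, GradedRing.proj 𝒜 i x ∈ S)
    (hnonneg : ∀ x ∈ S, ∀ i : ℤ, i < 0 → GradedRing.proj 𝒜 i x = 0)
    (hltc : ∀ x : Q, (∃ n : ℤ, 0 ≤ n ∧ ∀ s ∈ degGE 𝒜 S n, s * x ∈ S) → x ∈ S)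
    (n : ℤ) (hn : 0 ≤ n)
    (hTS : ∀ t ∈ maxRightTorsExt 𝒜 S, ∀ s ∈ degGE 𝒜 S n, t * s ∈ S) :
    (S : Set Q) = {θ : Q | ∀ a ∈ torsLeftIdeal 𝒜 S n, a * θ ∈ torsLeftIdeal 𝒜 S n} := by
  ext θ
  constructor
  · intro hθ a ha
    induction ha using AddSubgroup.closure_induction with
    | mem a ha =>
      obtain ⟨t, ht, s, hs, rfl⟩ := ha
      refine AddSubgroup.subset_closure ⟨t, ht, s * θ, ⟨S.mul_mem hs.1 hθ, fun i hi => ?_⟩,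
        mul_assoc t s θ⟩
      exact GradedRing.proj_mul_eq_zero_of_lt 𝒜 hs.2 (hnonneg θ hθ) (by rwa [add_zero])
    | zero => simp
    | add a b _ _ ha hb => simpa only [add_mul] using add_mem ha hb
    | neg a _ ha => simpa only [neg_mul] using neg_mem ha
  · intro hθ
    have hIS : torsLeftIdeal 𝒜 S n ≤ S.toAddSubgroup := by
      refine (AddSubgroup.closure_le _).2 ?_
      rintro _ ⟨t, ht, s, hs, rfl⟩
      exact hTS t ht s hs
    have one_mem_ext : (1 : Q) ∈ maxRightTorsExt 𝒜 S :=
      ⟨0, le_rfl, fun s hs => by simpa only [one_mul] using hs.1⟩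
    refine hltc θ ⟨n, hn, fun s hs => hIS (hθ s ?_)⟩
    exact AddSubgroup.subset_closure ⟨1, one_mem_ext, s, hs, (one_mul s).symm⟩
end

section
/- Let Q be a ℤ-graded ring and S a graded subring of Q contained in nonnegative degrees, and let T = T(S) be the maximal right torsion extension of S in Q. Suppose that S is left torsion closed in Q and that T·S_{≥n} ⊆ S for some n ≥ 0. Then T is left torsion closed over itself: if x ∈ Q satisfies t·x ∈ T for every t ∈ T ∩ ⊕_{i≥m} Q_i, for some m ≥ 0, then x ∈ T. -/
variable {Q : Type*} [Ring Q]

/-- The set `T(S)_{≥m} = T(S) ∩ ⊕_{i≥m} Q_i`. -/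
def torsGE (𝒜 : ℤ → AddSubgroup Q) [GradedRing 𝒜] (S : Subring Q) (m : ℤ) : Set Q :=
  {x | x ∈ maxRightTorsExt 𝒜 S ∧ ∀ i : ℤ, i < m → GradedRing.proj 𝒜 i x = 0}

/-- **Corollary 7.2(3), algebraic core.** Let `S` be a graded subring, contained in
nonnegative degrees, of a `ℤ`-graded ring `Q`, and let `T = T(S)` be the maximal right
torsion extension of `S` in `Q`.  If `S` is left torsion closed in `Q` and
`T·S_{≥n} ⊆ S` for some `n ≥ 0`, then `T` is left torsion closed over itself: whenever
`x ∈ Q` satisfies `t·x ∈ T` for every `t ∈ T ∩ ⊕_{i ≥ m} Q_i`, for some `m ≥ 0`,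
then `x ∈ T`. -/
theorem torsExt_leftTorsionClosed (𝒜 : ℤ → AddSubgroup Q) [GradedRing 𝒜] (S : Subring Q)
    (hcomp : ∀ x ∈ S, ∀ i : ℤ, GradedRing.proj 𝒜 i x ∈ S)
    (hnonneg : ∀ x ∈ S, ∀ i : ℤ, i < 0 → GradedRing.proj 𝒜 i x = 0)
    (hltc : ∀ x : Q, (∃ n : ℤ, 0 ≤ n ∧ ∀ s ∈ degGE 𝒜 S n, s * x ∈ S) → x ∈ S)
    (n : ℤ) (hn : 0 ≤ n)
    (hTS : ∀ t ∈ maxRightTorsExt 𝒜 S, ∀ s ∈ degGE 𝒜 S n, t * s ∈ S) :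
    ∀ x : Q, (∃ m : ℤ, 0 ≤ m ∧ ∀ t ∈ torsGE 𝒜 S m, t * x ∈ maxRightTorsExt 𝒜 S) →
      x ∈ maxRightTorsExt 𝒜 S := by
  rintro x ⟨m, hm, hx⟩
  refine ⟨n, hn, fun s hs ↦ hltc (x * s) ⟨m, hm, fun t ht ↦ ?_⟩⟩
  have htT : t ∈ torsGE 𝒜 S m := ⟨⟨0, le_rfl, fun u hu ↦ S.mul_mem ht.1 hu.1⟩, ht.2⟩
  rw [← mul_assoc]
  exact hTS (t * x) (hx t htT) s hs
end

section
/- Let S = ⊕_{n≥0} S_n be an ℕ-graded ring and let t ≥ 1 be such that S_n·S_m = S_{n+m} for all n, m ≥ t, where S_n·S_m denotes the additive subgroup generated by products. Let L = ⊕_{w∈ℤ} L_w be a graded right S-module generated by finitely many homogeneous elements, and suppose that L_{it} = 0 for every integer i. Then L is right bounded: L_w = 0 for all sufficiently large w. -/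
/-- For additive subgroups `P, R` of a ring `A`, the additive subgroup `P·R`
generated by the products `p * r` with `p ∈ P` and `r ∈ R`. -/
def addSubgroupMul {A : Type*} [Ring A] (P R : AddSubgroup A) : AddSubgroup A :=
  AddSubgroup.closure {x : A | ∃ p ∈ P, ∃ r ∈ R, x = p * r}

/-- Every integer can be moved to a multiple of `t` by adding a natural number in `[t, 2t)`. -/
theorem exists_nat_add_eq_mul {t : ℕ} (ht : 1 ≤ t) (r : ℤ) :
    ∃ m : ℕ, t ≤ m ∧ m < 2 * t ∧ ∃ i : ℤ, r + m = i * t := by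
  have ht₀ : (0 : ℤ) < t := by exact_mod_cast ht
  have hnonneg := Int.emod_nonneg (-r) ht₀.ne'
  have hlt := Int.emod_lt_of_pos (-r) ht₀
  refine ⟨t + ((-r) % t).toNat, by omega, by omega, 1 - (-r) / t, ?_⟩
  have hdiv := Int.emod_add_mul_ediv (-r) t
  push_cast
  rw [Int.toNat_of_nonneg hnonneg]
  linear_combination hdiv

/-- If `x` is killed by `P`, then it is killed by `P·R`. -/
theorem op_smul_eq_zero_of_mem_addSubgroupMul {A L : Type*} [Ring A] [AddCommGroup L]
    [Module Aᵐᵒᵖ L] {P R : AddSubgroup A} {x : L}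
    (hx : ∀ p ∈ P, MulOpposite.op p • x = 0) {s : A} (hs : s ∈ addSubgroupMul P R) :
    MulOpposite.op s • x = 0 := by
  induction hs using AddSubgroup.closure_induction with
  | mem y hy =>
    obtain ⟨p, hp, q, -, rfl⟩ := hy
    rw [MulOpposite.op_mul, mul_smul, hx p hp, smul_zero]
  | zero => rw [MulOpposite.op_zero, zero_smul]
  | add y z _ _ hy hz => rw [MulOpposite.op_add, add_smul, hy, hz, add_zero]
  | neg y _ hy => rw [MulOpposite.op_neg, neg_smul, hy, neg_zero]

/-- **Key step in the proof of Lemma 7.7(1).** Let `S = ⊕_{n≥0} S_n` be an ℕ-graded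
ring and `t ≥ 1` such that `S_n·S_m = S_{n+m}` for all `n, m ≥ t`.  Let
`L = ⊕_{w∈ℤ} L_w` be a graded right `S`-module generated by finitely many homogeneous
elements `a_j` of degrees `r_j` (so that `L_w = Σ_j a_j·S_{w − r_j}` for all `w`), and
suppose that `L_{it} = 0` for every integer `i`.  Then `L` is right bounded:
`L_w = 0` for all sufficiently large `w`. -/
theorem graded_module_right_bounded {A L : Type*} [Ring A] [AddCommGroup L]
    [Module Aᵐᵒᵖ L]
    (𝒜 : ℕ → AddSubgroup A) [GradedRing 𝒜]
    (t : ℕ) (ht : 1 ≤ t)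
    (hmul : ∀ m n, t ≤ m → t ≤ n → addSubgroupMul (𝒜 m) (𝒜 n) = 𝒜 (m + n))
    (ℒ : ℤ → AddSubgroup L)
    (hsmul : ∀ (w : ℤ) (n : ℕ), ∀ x ∈ ℒ w, ∀ s ∈ 𝒜 n,
      (MulOpposite.op s) • x ∈ ℒ (w + n))
    {ι : Type*} [Fintype ι] (a : ι → L) (r : ι → ℤ)
    (ha : ∀ j, a j ∈ ℒ (r j))
    (hgen : ∀ w : ℤ, ℒ w = AddSubgroup.closure
      {x : L | ∃ j : ι, ∃ n : ℕ, r j + n = w ∧ ∃ s ∈ 𝒜 n, x = (MulOpposite.op s) • a j})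
    (hvanish : ∀ i : ℤ, ℒ (i * (t : ℤ)) = ⊥) :
    ∃ w₀ : ℤ, ∀ w : ℤ, w₀ ≤ w → ℒ w = ⊥ := by
  obtain ⟨b, hb⟩ := (Set.finite_range r).bddAbove
  refine ⟨b + 3 * t, fun w hw => ?_⟩
  rw [hgen, AddSubgroup.closure_eq_bot_iff]
  rintro _ ⟨j, n, hn, s, hs, rfl⟩
  have hrj : r j ≤ b := hb ⟨j, rfl⟩
  obtain ⟨m, hm, hm', i, hi⟩ := exists_nat_add_eq_mul ht (r j)
  have hs' : s ∈ addSubgroupMul (𝒜 m) (𝒜 (n - m)) := by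
    rwa [hmul m (n - m) hm (by omega), Nat.add_sub_cancel' (by omega)]
  refine op_smul_eq_zero_of_mem_addSubgroupMul (fun p hp => ?_) hs'
  have hmem := hsmul (r j) m (a j) (ha j) p hp
  rwa [hi, hvanish, AddSubgroup.mem_bot] at hmem
end

section
/- Let k be a field and work in the polynomial ring k[x,y] with 𝔪 = (x,y). Define the ideals J = (x⁶, x⁵y, xy⁵, y⁶) + 𝔪⁷, Q = J + (x³y³), I = (x⁴y², x²y⁴) + 𝔪⁷, P = I + (x³y³), and K = (x¹⁰y², x⁹y³, x⁸y⁴, x⁷y⁵, x⁵y⁷, x⁴y⁸, x³y⁹, x²y¹⁰) + 𝔪¹³. Then the strict inclusions P ⊋ I ⊋ K and K ⊊ J ⊊ Q hold, and P·J = I·J = I·Q = K. Moreover x⁶y⁶ ∉ K. -/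
open MvPolynomial

section Example510

variable (k : Type*) [Field k]

/-- The variable `x` in `k[x,y]`. -/
noncomputable def egX : MvPolynomial (Fin 2) k := X 0

/-- The variable `y` in `k[x,y]`. -/
noncomputable def egY : MvPolynomial (Fin 2) k := X 1

/-- The irrelevant maximal ideal `𝔪 = (x, y)` of `k[x,y]`. -/
noncomputable def egM : Ideal (MvPolynomial (Fin 2) k) := Ideal.span {egX k, egY k}

/-- `J = (x⁶, x⁵y, xy⁵, y⁶) + 𝔪⁷`. -/
noncomputable def egJ : Ideal (MvPolynomial (Fin 2) k) :=
  Ideal.span {egX k ^ 6, egX k ^ 5 * egY k, egX k * egY k ^ 5, egY k ^ 6} ⊔ egM k ^ 7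

/-- `Q = J + (x³y³)`. -/
noncomputable def egQ : Ideal (MvPolynomial (Fin 2) k) :=
  egJ k ⊔ Ideal.span {egX k ^ 3 * egY k ^ 3}

/-- `I = (x⁴y², x²y⁴) + 𝔪⁷`. -/
noncomputable def egI : Ideal (MvPolynomial (Fin 2) k) :=
  Ideal.span {egX k ^ 4 * egY k ^ 2, egX k ^ 2 * egY k ^ 4} ⊔ egM k ^ 7

/-- `P = I + (x³y³)`. -/
noncomputable def egP : Ideal (MvPolynomial (Fin 2) k) :=
  egI k ⊔ Ideal.span {egX k ^ 3 * egY k ^ 3}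

/-- `K = (x¹⁰y², x⁹y³, x⁸y⁴, x⁷y⁵, x⁵y⁷, x⁴y⁸, x³y⁹, x²y¹⁰) + 𝔪¹³`. -/
noncomputable def egK : Ideal (MvPolynomial (Fin 2) k) :=
  Ideal.span {egX k ^ 10 * egY k ^ 2, egX k ^ 9 * egY k ^ 3, egX k ^ 8 * egY k ^ 4,
    egX k ^ 7 * egY k ^ 5, egX k ^ 5 * egY k ^ 7, egX k ^ 4 * egY k ^ 8,
    egX k ^ 3 * egY k ^ 9, egX k ^ 2 * egY k ^ 10} ⊔ egM k ^ 13

theorem egX_pow_mul_egY_pow_mem_egM_pow {n i j : ℕ} (h : n ≤ i + j) :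
    egX k ^ i * egY k ^ j ∈ egM k ^ n := by
  refine Ideal.pow_le_pow_right h ?_
  rw [pow_add]
  exact Ideal.mul_mem_mul (Ideal.pow_mem_pow (Ideal.subset_span (by simp)) i)
    (Ideal.pow_mem_pow (Ideal.subset_span (by simp)) j)

theorem egM_pow_eq_span (n : ℕ) :
    egM k ^ n = Ideal.span {f | ∃ i j, i + j = n ∧ f = egX k ^ i * egY k ^ j} := by
  refine le_antisymm ?_ (Ideal.span_le.2 ?_)
  · induction n with
    | zero =>
      rw [pow_zero, Ideal.one_eq_top, top_le_iff, Ideal.eq_top_iff_one]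
      exact Ideal.subset_span ⟨0, 0, rfl, by simp⟩
    | succ n ih =>
      rw [pow_succ]
      refine (Ideal.mul_mono_left ih).trans ?_
      rw [egM, Ideal.span_mul_span', Ideal.span_le]
      rintro _ ⟨_, ⟨i, j, rfl, rfl⟩, _, rfl | rfl, rfl⟩
      · exact Ideal.subset_span ⟨i + 1, j, by ring, by ring⟩
      · exact Ideal.subset_span ⟨i, j + 1, by ring, by ring⟩
  · rintro _ ⟨i, j, rfl, rfl⟩
    exact egX_pow_mul_egY_pow_mem_egM_pow k le_rfl

theorem egX_pow_mul_egY_pow_eq_monomial (i j : ℕ) :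
    egX k ^ i * egY k ^ j = monomial (Finsupp.single 0 i + Finsupp.single 1 j) 1 := by
  simp [egX, egY, X_pow_eq_monomial, monomial_mul]

/-- A monomial of degree less than `d` which is divisible by none of the monomials in `S` is not
in the ideal `(S) + 𝔪 ^ d`. -/
theorem egX_pow_mul_egY_pow_notMem {S : Set (MvPolynomial (Fin 2) k)} {d i j : ℕ} (hd : i + j < d)
    (hS : ∀ f ∈ S, ∃ a b, f = egX k ^ a * egY k ^ b ∧ ¬ (a ≤ i ∧ b ≤ j)) :
    egX k ^ i * egY k ^ j ∉ Ideal.span S ⊔ egM k ^ d := by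
  intro h
  have hle : Ideal.span S ⊔ egM k ^ d ≤ Ideal.span ((fun s => monomial s (1 : k)) ''
      {s : Fin 2 →₀ ℕ | ¬ (s 0 ≤ i ∧ s 1 ≤ j)}) := by
    rw [egM_pow_eq_span, ← Ideal.span_union, Ideal.span_le]
    have key (a b : ℕ) (hab : ¬ (a ≤ i ∧ b ≤ j)) :
        egX k ^ a * egY k ^ b ∈ Ideal.span ((fun s => monomial s (1 : k)) ''
          {s : Fin 2 →₀ ℕ | ¬ (s 0 ≤ i ∧ s 1 ≤ j)}) :=
      Ideal.subset_span ⟨_, by simpa using hab, (egX_pow_mul_egY_pow_eq_monomial k a b).symm⟩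
    rintro f (hf | ⟨a, b, hab, rfl⟩)
    · obtain ⟨a, b, rfl, hab⟩ := hS f hf
      exact key a b hab
    · exact key a b (by omega)
  obtain ⟨s, hs, hsle⟩ := mem_ideal_span_monomial_image.1 (hle h)
    (Finsupp.single 0 i + Finsupp.single 1 j) (by
      classical
      rw [egX_pow_mul_egY_pow_eq_monomial, mem_support_iff, coeff_monomial, if_pos rfl]
      exact one_ne_zero)
  exact hs ⟨by simpa using hsle 0, by simpa using hsle 1⟩

theorem egX_pow_mul_egY_pow_notMem_of_lt {d i j : ℕ} (hd : i + j < d) :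
    egX k ^ i * egY k ^ j ∉ egM k ^ d := by
  simpa using egX_pow_mul_egY_pow_notMem k (S := ∅) hd (by simp)

theorem egK_le_egM_pow : egK k ≤ egM k ^ 12 := by
  refine sup_le (Ideal.span_le.2 ?_) (Ideal.pow_le_pow_right (by norm_num))
  rintro f (rfl | rfl | rfl | rfl | rfl | rfl | rfl | rfl) <;>
    exact egX_pow_mul_egY_pow_mem_egM_pow k (by norm_num)

theorem egQ_le_egM_pow : egQ k ≤ egM k ^ 6 := by
  refine sup_le (sup_le (Ideal.span_le.2 ?_) (Ideal.pow_le_pow_right (by norm_num)))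
    (Ideal.span_le.2 ?_)
  · rintro f (rfl | rfl | rfl | rfl)
    · simpa using egX_pow_mul_egY_pow_mem_egM_pow k (n := 6) (i := 6) (j := 0) le_rfl
    · simpa using egX_pow_mul_egY_pow_mem_egM_pow k (n := 6) (i := 5) (j := 1) le_rfl
    · simpa using egX_pow_mul_egY_pow_mem_egM_pow k (n := 6) (i := 1) (j := 5) le_rfl
    · simpa using egX_pow_mul_egY_pow_mem_egM_pow k (n := 6) (i := 0) (j := 6) le_rfl
  · rintro f rfl
    exact egX_pow_mul_egY_pow_mem_egM_pow k le_rfl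

theorem egP_le_egM_pow : egP k ≤ egM k ^ 6 := by
  refine sup_le (sup_le (Ideal.span_le.2 ?_) (Ideal.pow_le_pow_right (by norm_num)))
    (Ideal.span_le.2 ?_)
  · rintro f (rfl | rfl) <;> exact egX_pow_mul_egY_pow_mem_egM_pow k (by norm_num)
  · rintro f rfl
    exact egX_pow_mul_egY_pow_mem_egM_pow k le_rfl

/-- If `A, B ⊆ 𝔪 ^ 6` are generated by `S`, `T` modulo `𝔪 ^ 7`, then `A * B ⊆ K` can be tested on
the products of elements of `S` and `T`. -/
theorem mul_le_egK {A B : Ideal (MvPolynomial (Fin 2) k)} {S T : Set (MvPolynomial (Fin 2) k)}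
    (hA : A ≤ Ideal.span S ⊔ egM k ^ 7) (hB : B ≤ Ideal.span T ⊔ egM k ^ 7)
    (hS : Ideal.span S ≤ egM k ^ 6) (hT : Ideal.span T ≤ egM k ^ 6)
    (h : ∀ f ∈ S, ∀ g ∈ T, f * g ∈ egK k) : A * B ≤ egK k := by
  have hM : egM k ^ 13 ≤ egK k := le_sup_right
  refine (Ideal.mul_mono hA hB).trans ?_
  rw [Ideal.sup_mul, Ideal.mul_sup, Ideal.mul_sup]
  refine sup_le (sup_le ?_ ?_) (sup_le ?_ ?_)
  · rw [Ideal.span_mul_span', Ideal.span_le]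
    rintro _ ⟨f, hf, g, hg, rfl⟩
    exact h f hf g hg
  · exact (Ideal.mul_mono_left hS).trans ((pow_add _ 6 7).ge.trans hM)
  · exact (Ideal.mul_mono_right hT).trans ((pow_add _ 7 6).ge.trans hM)
  · exact (pow_add _ 7 7).ge.trans ((Ideal.pow_le_pow_right (by norm_num)).trans hM)

theorem egP_mul_egJ_le : egP k * egJ k ≤ egK k := by
  refine mul_le_egK k
    (S := {egX k ^ 4 * egY k ^ 2, egX k ^ 2 * egY k ^ 4} ∪ {egX k ^ 3 * egY k ^ 3}) ?_ le_rfl ?_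
    ((le_sup_left.trans le_sup_left).trans (egQ_le_egM_pow k)) ?_
  · rw [Ideal.span_union, sup_right_comm]; rfl
  · rw [Ideal.span_union]
    exact (sup_le_sup_right le_sup_left _).trans (egP_le_egM_pow k)
  · rintro f ((rfl | rfl) | rfl) g (rfl | rfl | rfl | rfl) <;>
      exact Ideal.mem_sup_left (Ideal.subset_span (by ring_nf; simp))

theorem egI_mul_egQ_le : egI k * egQ k ≤ egK k := by
  refine mul_le_egK k
    (T := {egX k ^ 6, egX k ^ 5 * egY k, egX k * egY k ^ 5, egY k ^ 6} ∪ {egX k ^ 3 * egY k ^ 3})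
    le_rfl ?_ ((le_sup_left.trans le_sup_left).trans (egP_le_egM_pow k)) ?_ ?_
  · rw [Ideal.span_union, sup_right_comm]; rfl
  · rw [Ideal.span_union]
    exact (sup_le_sup_right le_sup_left _).trans (egQ_le_egM_pow k)
  · rintro f (rfl | rfl) g ((rfl | rfl | rfl | rfl) | rfl) <;>
      exact Ideal.mem_sup_left (Ideal.subset_span (by ring_nf; simp))

theorem egK_le_egI_mul_egJ : egK k ≤ egI k * egJ k := by
  have i₁ : egX k ^ 4 * egY k ^ 2 ∈ egI k := Ideal.mem_sup_left (Ideal.subset_span (by simp))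
  have i₂ : egX k ^ 2 * egY k ^ 4 ∈ egI k := Ideal.mem_sup_left (Ideal.subset_span (by simp))
  have j₁ : egX k ^ 6 ∈ egJ k := Ideal.mem_sup_left (Ideal.subset_span (by simp))
  have j₂ : egX k ^ 5 * egY k ∈ egJ k := Ideal.mem_sup_left (Ideal.subset_span (by simp))
  have j₃ : egX k * egY k ^ 5 ∈ egJ k := Ideal.mem_sup_left (Ideal.subset_span (by simp))
  have j₄ : egY k ^ 6 ∈ egJ k := Ideal.mem_sup_left (Ideal.subset_span (by simp))
  refine sup_le (Ideal.span_le.2 ?_) ?_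
  · rintro f (rfl | rfl | rfl | rfl | rfl | rfl | rfl | rfl) <;> rw [SetLike.mem_coe]
    · convert Ideal.mul_mem_mul i₁ j₁ using 1; ring
    · convert Ideal.mul_mem_mul i₁ j₂ using 1; ring
    · convert Ideal.mul_mem_mul i₂ j₁ using 1; ring
    · convert Ideal.mul_mem_mul i₂ j₂ using 1; ring
    · convert Ideal.mul_mem_mul i₁ j₃ using 1; ring
    · convert Ideal.mul_mem_mul i₁ j₄ using 1; ring
    · convert Ideal.mul_mem_mul i₂ j₃ using 1; ring
    · convert Ideal.mul_mem_mul i₂ j₄ using 1; ring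
  · have hI {i j : ℕ} (h : 7 ≤ i + j) : egX k ^ i * egY k ^ j ∈ egI k :=
      Ideal.mem_sup_right (egX_pow_mul_egY_pow_mem_egM_pow k h)
    rw [egM_pow_eq_span, Ideal.span_le]
    rintro _ ⟨i, j, hij, rfl⟩
    rw [SetLike.mem_coe]
    rcases le_total 6 i with h | h
    · obtain ⟨i, rfl⟩ := Nat.exists_eq_add_of_le h
      convert Ideal.mul_mem_mul (hI (i := i) (j := j) (by omega)) j₁ using 1; ring
    · obtain ⟨j, rfl⟩ := Nat.exists_eq_add_of_le (show 6 ≤ j by omega)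
      convert Ideal.mul_mem_mul (hI (i := i) (j := j) (by omega)) j₄ using 1; ring

theorem egX_pow_three_mul_egY_pow_three_notMem_egI : egX k ^ 3 * egY k ^ 3 ∉ egI k := by
  refine egX_pow_mul_egY_pow_notMem k (by norm_num) ?_
  rintro f (rfl | rfl)
  · exact ⟨4, 2, rfl, by norm_num⟩
  · exact ⟨2, 4, rfl, by norm_num⟩

theorem egX_pow_three_mul_egY_pow_three_notMem_egJ : egX k ^ 3 * egY k ^ 3 ∉ egJ k := by
  refine egX_pow_mul_egY_pow_notMem k (by norm_num) ?_
  rintro f (rfl | rfl | rfl | rfl)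
  · exact ⟨6, 0, by ring, by norm_num⟩
  · exact ⟨5, 1, by ring, by norm_num⟩
  · exact ⟨1, 5, by ring, by norm_num⟩
  · exact ⟨0, 6, by ring, by norm_num⟩

theorem egX_pow_six_mul_egY_pow_six_notMem_egK : egX k ^ 6 * egY k ^ 6 ∉ egK k := by
  refine egX_pow_mul_egY_pow_notMem k (by norm_num) ?_
  rintro f (rfl | rfl | rfl | rfl | rfl | rfl | rfl | rfl) <;> exact ⟨_, _, rfl, by norm_num⟩

/-- **Example 5.10 of the paper (ideal identities).** In `k[x,y]` one has the strict
inclusions `P ⊋ I ⊋ K` and `K ⊊ J ⊊ Q`, the products satisfy `P·J = I·J = I·Q = K`,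
and `x⁶y⁶ ∉ K`. -/
theorem example510_ideal_identities :
    egK k < egI k ∧ egI k < egP k ∧ egK k < egJ k ∧ egJ k < egQ k ∧
      egP k * egJ k = egK k ∧ egI k * egJ k = egK k ∧ egI k * egQ k = egK k ∧
      egX k ^ 6 * egY k ^ 6 ∉ egK k := by
  have hIP : egI k ≤ egP k := le_sup_left
  have hJQ : egJ k ≤ egQ k := le_sup_left
  have hPJ := egP_mul_egJ_le k
  have hIQ := egI_mul_egQ_le k
  have hK := egK_le_egI_mul_egJ k
  have hKnot (i j : ℕ) (h : i + j < 12) : egX k ^ i * egY k ^ j ∉ egK k := fun hmem =>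
    egX_pow_mul_egY_pow_notMem_of_lt k h (egK_le_egM_pow k hmem)
  refine ⟨lt_of_le_not_ge (hK.trans Ideal.mul_le_left) fun h => ?_,
    lt_of_le_not_ge hIP fun h => ?_,
    lt_of_le_not_ge (hK.trans Ideal.mul_le_right) fun h => ?_,
    lt_of_le_not_ge hJQ fun h => ?_,
    le_antisymm hPJ (hK.trans (Ideal.mul_mono_left hIP)),
    le_antisymm ((Ideal.mul_mono_left hIP).trans hPJ) hK,
    le_antisymm hIQ (hK.trans (Ideal.mul_mono_right hJQ)),
    egX_pow_six_mul_egY_pow_six_notMem_egK k⟩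
  · exact hKnot 4 2 (by norm_num) (h (Ideal.mem_sup_left (Ideal.subset_span (by simp))))
  · exact egX_pow_three_mul_egY_pow_three_notMem_egI k
      (h (Ideal.mem_sup_right (Ideal.mem_span_singleton_self _)))
  · exact hKnot 6 0 (by norm_num) (h (Ideal.mem_sup_left (Ideal.subset_span (by simp))))
  · exact egX_pow_three_mul_egY_pow_three_notMem_egJ k
      (h (Ideal.mem_sup_right (Ideal.mem_span_singleton_self _)))

end Example510
end

section
/- Let k be a field and work in the polynomial ring k[x,y] with 𝔪 = (x,y). Define the ideals J = (x⁶, x⁵y, xy⁵, y⁶) + 𝔪⁷, Q = J + (x³y³), I = (x⁴y², x²y⁴) + 𝔪⁷, P = I + (x³y³), and K = (x¹⁰y², x⁹y³, x⁸y⁴, x⁷y⁵, x⁵y⁷, x⁴y⁸, x³y⁹, x²y¹⁰) + 𝔪¹³. Then the colon-ideal identities P = (K : J), J = (K : P), Q = (K : I), and I = (K : Q) all hold. -/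
open MvPolynomial

section Example510

variable (k : Type*) [Field k]

variable {k} in
theorem MvPolynomial.mem_span_monomial_iff_of_isUpperSet {σ : Type*} {U : Set (σ →₀ ℕ)}
    (hU : IsUpperSet U) {p : MvPolynomial σ k} :
    p ∈ Ideal.span ((fun s ↦ monomial s (1 : k)) '' U) ↔ ∀ s ∈ p.support, s ∈ U := by
  rw [mem_ideal_span_monomial_image]
  exact forall₂_congr fun s _ ↦ ⟨fun ⟨_, ht, hts⟩ ↦ hU hts ht, fun hs ↦ ⟨s, hs, le_rfl⟩⟩

theorem MvPolynomial.span_monomial_colon_span_monomial {σ : Type*} {U V W : Set (σ →₀ ℕ)}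
    (hU : IsUpperSet U) (hW : IsUpperSet W) (h : ∀ s, s ∈ W ↔ ∀ t ∈ V, s + t ∈ U) :
    (Ideal.span ((fun s ↦ monomial s (1 : k)) '' U)).colon
        (Ideal.span ((fun s ↦ monomial s (1 : k)) '' V) : Ideal (MvPolynomial σ k)) =
      Ideal.span ((fun s ↦ monomial s (1 : k)) '' W) := by
  ext p
  rw [Ideal.colon_span, Submodule.mem_colon, Set.forall_mem_image,
    mem_span_monomial_iff_of_isUpperSet hW]
  simp only [smul_eq_mul, mem_span_monomial_iff_of_isUpperSet hU, h]
  refine ⟨fun hp s hs t ht ↦ hp ht (s + t) ?_, fun hp t ht u hu ↦ ?_⟩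
  · simpa [mem_support_iff, coeff_mul_monomial] using hs
  · rw [mem_support_iff, coeff_mul_monomial', mul_one] at hu
    split_ifs at hu with htu
    · exact tsub_add_cancel_of_le htu ▸ hp (u - t) (mem_support_iff.mpr hu) t ht
    · exact absurd rfl hu

/-- The exponents of total degree greater than `d`, together with those of total degree `d` whose
first entry lies in `S`. -/
def exponentsAbove (d : ℕ) (S : Set ℕ) : Set (Fin 2 →₀ ℕ) :=
  {s | d < s 0 + s 1 ∨ s 0 + s 1 = d ∧ s 0 ∈ S}

theorem isUpperSet_exponentsAbove (d : ℕ) (S : Set ℕ) : IsUpperSet (exponentsAbove d S) := by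
  intro s t hst hs
  have h0 := hst 0
  have h1 := hst 1
  rcases hs with hs | ⟨hs, hS⟩
  · exact Or.inl (by omega)
  · by_cases h : s 0 + s 1 = t 0 + t 1
    · exact Or.inr ⟨by omega, (show s 0 = t 0 by omega) ▸ hS⟩
    · exact Or.inl (by omega)

/-- The ideal of `k[x,y]` spanned by all monomials of degree greater than `d`, together with the
monomials of degree `d` whose exponent of `x` lies in `S`. -/
noncomputable def idealAbove (d : ℕ) (S : Set ℕ) : Ideal (MvPolynomial (Fin 2) k) :=
  Ideal.span ((fun s ↦ monomial s (1 : k)) '' exponentsAbove d S)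

theorem monomial_fin_two_one (s : Fin 2 →₀ ℕ) :
    monomial s (1 : k) = egX k ^ s 0 * egY k ^ s 1 := by
  rw [monomial_eq, C_1, one_mul, Finsupp.prod_fintype _ _ (by simp), Fin.prod_univ_two, egX, egY]

theorem egM_eq_idealOfVars : egM k = idealOfVars (Fin 2) k := by
  rw [egM, idealOfVars, egX, egY]
  congr 1
  ext p
  simp [Fin.exists_fin_two, eq_comm]

theorem span_image_sup_egM_pow {d : ℕ} {S : Set ℕ} (hS : ∀ a ∈ S, a ≤ d) :
    Ideal.span ((fun a ↦ egX k ^ a * egY k ^ (d - a)) '' S) ⊔ egM k ^ (d + 1) =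
      idealAbove k d S := by
  apply le_antisymm
  · refine sup_le (Ideal.span_le.mpr ?_) ?_
    · rintro _ ⟨a, ha, rfl⟩
      refine Ideal.subset_span ⟨Finsupp.single 0 a + Finsupp.single 1 (d - a), Or.inr ?_, ?_⟩
      · simpa [ha] using Nat.add_sub_of_le (hS a ha)
      · simp [monomial_fin_two_one]
    · rw [egM_eq_idealOfVars, pow_idealOfVars_eq_span]
      refine Ideal.span_mono (Set.image_mono fun s hs ↦ Or.inl ?_)
      simp only [Set.mem_preimage, Set.mem_singleton_iff, Finsupp.degree_eq_sum,
        Fin.sum_univ_two] at hs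
      omega
  · refine Ideal.span_le.mpr ?_
    rintro _ ⟨s, hs | ⟨hs, hsS⟩, rfl⟩
    · refine Ideal.mem_sup_right ?_
      rw [egM_eq_idealOfVars, monomial_mem_pow_idealOfVars_iff _ _ one_ne_zero,
        Finsupp.degree_eq_sum, Fin.sum_univ_two]
      exact hs
    · refine Ideal.mem_sup_left (Ideal.subset_span ⟨s 0, hsS, ?_⟩)
      simp only [monomial_fin_two_one, ← hs, Nat.add_sub_cancel_left]

theorem idealAbove_colon_idealAbove {d e : ℕ} {R S T : Set ℕ} (hS : ∀ b ∈ S, b ≤ d)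
    (hne : S.Nonempty) (hR : ∀ a ≤ e, a ∈ R ↔ ∀ b ∈ S, a + b ∈ T) :
    (idealAbove k (e + d) T).colon (idealAbove k d S) = idealAbove k e R := by
  refine span_monomial_colon_span_monomial k (isUpperSet_exponentsAbove _ _)
    (isUpperSet_exponentsAbove _ _) fun s ↦ ⟨?_, fun h ↦ ?_⟩
  · rintro hs t ht
    simp only [exponentsAbove, Set.mem_ofPred_eq, Finsupp.add_apply] at hs ht ⊢
    rcases hs with hs | ⟨hs, hsR⟩
    · exact Or.inl (by omega)
    rcases ht with ht | ⟨ht, htS⟩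
    · exact Or.inl (by omega)
    · exact Or.inr ⟨by omega, (hR _ (by omega)).mp hsR _ htS⟩
  · have key (b : ℕ) (hb : b ∈ S) :
        e < s 0 + s 1 ∨ s 0 + s 1 = e ∧ s 0 + b ∈ T := by
      have hbd := hS b hb
      have hmem := h (Finsupp.single 0 b + Finsupp.single 1 (d - b))
        (Or.inr (by simpa [hb] using Nat.add_sub_of_le hbd))
      simp only [exponentsAbove, Set.mem_ofPred_eq, Finsupp.add_apply] at hmem
      simp only [Finsupp.single_apply, Fin.isValue, if_true, zero_ne_one, one_ne_zero, if_false,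
        add_zero, zero_add] at hmem
      rcases hmem with hlt | ⟨heq, hT⟩
      · exact Or.inl (by omega)
      · exact Or.inr ⟨by omega, hT⟩
    by_cases hlt : e < s 0 + s 1
    · exact Or.inl hlt
    · obtain ⟨b, hb⟩ := hne
      have hse := ((key b hb).resolve_left hlt).1
      exact Or.inr ⟨hse, (hR _ (by omega)).mpr fun c hc ↦ ((key c hc).resolve_left hlt).2⟩

theorem egJ_eq_idealAbove : egJ k = idealAbove k 6 {6, 5, 1, 0} := by
  rw [← span_image_sup_egM_pow k (by simp), egJ]
  simp [Set.image_insert_eq]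

theorem egI_eq_idealAbove : egI k = idealAbove k 6 {4, 2} := by
  rw [← span_image_sup_egM_pow k (by simp), egI]
  simp [Set.image_insert_eq]

theorem egQ_eq_idealAbove : egQ k = idealAbove k 6 {3, 6, 5, 1, 0} := by
  rw [← span_image_sup_egM_pow k (by simp), Set.image_insert_eq, Ideal.span_insert, sup_assoc,
    span_image_sup_egM_pow k (by simp), ← egJ_eq_idealAbove, egQ, sup_comm]

theorem egP_eq_idealAbove : egP k = idealAbove k 6 {3, 4, 2} := by
  rw [← span_image_sup_egM_pow k (by simp), Set.image_insert_eq, Ideal.span_insert, sup_assoc,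
    span_image_sup_egM_pow k (by simp), ← egI_eq_idealAbove, egP, sup_comm]

theorem egK_eq_idealAbove : egK k = idealAbove k (6 + 6) {10, 9, 8, 7, 5, 4, 3, 2} := by
  rw [← span_image_sup_egM_pow k (by simp), egK]
  simp [Set.image_insert_eq]

/-- **Example 5.10 of the paper (colon-ideal identities).** In `k[x,y]` one has
`P = (K : J)`, `J = (K : P)`, `Q = (K : I)`, and `I = (K : Q)`. -/
theorem example510_colon_identities :
    egP k = (egK k).colon (egJ k) ∧ egJ k = (egK k).colon (egP k) ∧
      egQ k = (egK k).colon (egI k) ∧ egI k = (egK k).colon (egQ k) := by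
  rw [egP_eq_idealAbove, egJ_eq_idealAbove, egQ_eq_idealAbove, egI_eq_idealAbove,
    egK_eq_idealAbove]
  refine ⟨?_, ?_, ?_, ?_⟩ <;>
    refine (idealAbove_colon_idealAbove k (by simp) (by simp) fun a ha ↦ ?_).symm <;>
    interval_cases a <;> simp

end Example510
end
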